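/- arXiv:2601.19327 — 8 statements merged into one kernel-verified Lean document; each statement's English description precedes it below -/
import Mathlib

section
/- Let k > 1 be real and let α_k be the unique positive solution to x(1+x)^{k-1} = 1. Then for all x with 0 ≤ x ≤ 1, α_k · h(x^k) ≥ x^{k-1} · h(x), where h is the binary entropy function. -/
/-- The binary entropy function `h(x) = -x log x - (1-x) log (1-x)`,
with the conventions `h 0 = h 1 = 0` (automatic since `Real.log 0 = 0`). -/
noncomputable def binEntropy (x : ℝ) : ℝ :=
  -(x * Real.log x) - (1 - x) * Real.log (1 - x)

open Set

theorem binEntropy_eq_real_binEntropy : binEntropy = Real.binEntropy := by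
  funext x
  simp only [binEntropy, Real.binEntropy, Real.log_inv]
  ring

theorem integral_const_rpow {z : ℝ} (hz : 0 < z) (hz1 : z ≠ 1) :
    ∫ s in (0 : ℝ)..1, z ^ s = (z - 1) / Real.log z := by
  have hlog : Real.log z ≠ 0 := Real.log_ne_zero_of_pos_of_ne_one hz hz1
  have hderiv (s : ℝ) : HasDerivAt (fun s : ℝ => z ^ s / Real.log z) (z ^ s) s := by
    have h := ((hasDerivAt_id s).const_rpow hz).div_const (Real.log z)
    refine h.congr_deriv ?_
    simp only [id]
    field_simp
  rw [intervalIntegral.integral_eq_sub_of_hasDerivAt (fun s _ => hderiv s)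
    ((Real.continuous_const_rpow hz.ne').intervalIntegrable _ _)]
  simp [sub_div]

/-- The logarithmic mean of `z` and `1` is concave in `z`. -/
theorem concaveOn_sub_one_div_log :
    ConcaveOn ℝ (Ioo 0 1) (fun z : ℝ => (z - 1) / Real.log z) := by
  refine ⟨convex_Ioo 0 1, fun x hx y hy a b ha hb hab => ?_⟩
  have hc := convex_Ioo (0 : ℝ) 1 hx hy ha hb hab
  have hint {z : ℝ} (hz : z ∈ Ioo (0 : ℝ) 1) :
      IntervalIntegrable (fun s : ℝ => z ^ s) MeasureTheory.volume 0 1 :=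
    (Real.continuous_const_rpow hz.1.ne').intervalIntegrable _ _
  simp only
  rw [← integral_const_rpow hx.1 hx.2.ne, ← integral_const_rpow hy.1 hy.2.ne,
    ← integral_const_rpow hc.1 hc.2.ne, smul_eq_mul, smul_eq_mul,
    ← intervalIntegral.integral_const_mul, ← intervalIntegral.integral_const_mul,
    ← intervalIntegral.integral_add ((hint hx).const_mul a) ((hint hy).const_mul b)]
  refine intervalIntegral.integral_mono_on zero_le_one
    (((hint hx).const_mul a).add ((hint hy).const_mul b)) (hint hc) fun s hs => ?_
  exact (Real.concaveOn_rpow hs.1 hs.2).2 hx.1.le hy.1.le ha hb hab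

/-- The function `log x * log (1 - x) / h x`, which governs the logarithmic derivative
of `h x / x`. -/
noncomputable def logMulLogDivEntropy (x : ℝ) : ℝ :=
  Real.log x * Real.log (1 - x) / Real.binEntropy x

theorem inv_logMulLogDivEntropy {x : ℝ} (hx : x ∈ Ioo (0 : ℝ) 1) :
    (logMulLogDivEntropy x)⁻¹ =
      (x - 1) / Real.log x + (1 - x - 1) / Real.log (1 - x) := by
  have h1 : Real.log x ≠ 0 := (Real.log_neg hx.1 hx.2).ne
  have h2 : Real.log (1 - x) ≠ 0 :=
    (Real.log_neg (by linarith [hx.2]) (by linarith [hx.1])).ne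
  rw [logMulLogDivEntropy, inv_div, Real.binEntropy, Real.log_inv, Real.log_inv]
  field_simp
  ring

theorem logMulLogDivEntropy_pos {x : ℝ} (hx : x ∈ Ioo (0 : ℝ) 1) :
    0 < logMulLogDivEntropy x :=
  div_pos (mul_pos_of_neg_of_neg (Real.log_neg hx.1 hx.2)
    (Real.log_neg (by linarith [hx.2]) (by linarith [hx.1]))) (Real.binEntropy_pos hx.1 hx.2)

theorem logMulLogDivEntropy_le_of_mem_segment {a y : ℝ} (ha : a ∈ Ioo (0 : ℝ) 1)
    (hy : y ∈ segment ℝ a (1 - a)) : logMulLogDivEntropy y ≤ logMulLogDivEntropy a := by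
  have ha' : 1 - a ∈ Ioo (0 : ℝ) 1 := ⟨by linarith [ha.2], by linarith [ha.1]⟩
  have hy01 : y ∈ Ioo (0 : ℝ) 1 := (convex_Ioo 0 1).segment_subset ha ha' hy
  rw [← inv_le_inv₀ (logMulLogDivEntropy_pos ha) (logMulLogDivEntropy_pos hy01),
    inv_logMulLogDivEntropy ha, inv_logMulLogDivEntropy hy01]
  obtain ⟨s, t, hs, ht, hst, rfl⟩ := hy
  have h1 := concaveOn_sub_one_div_log.2 ha ha' hs ht hst
  have h2 := concaveOn_sub_one_div_log.2 ha' ha hs ht hst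
  have he : s • (1 - a) + t • a = 1 - (s • a + t • (1 - a)) := by
    simp only [smul_eq_mul]
    linear_combination hst
  rw [he] at h2
  have hsum : ∀ A B : ℝ, A + B = (s * A + t * B) + (s * B + t * A) := fun A B => by
    linear_combination -(A + B) * hst
  rw [hsum]
  exact add_le_add h1 h2

theorem hasDerivAt_log_binEntropy_sub_log {x : ℝ} (hx : x ∈ Ioo (0 : ℝ) 1) :
    HasDerivAt (fun x => Real.log (Real.binEntropy x) - Real.log x)
      (logMulLogDivEntropy x / (x * Real.log x)) x := by
  have hh := (Real.binEntropy_pos hx.1 hx.2).ne'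
  have hx0 := hx.1.ne'
  have hl : Real.log x ≠ 0 := (Real.log_neg hx.1 hx.2).ne
  refine (((Real.hasDerivAt_binEntropy hx0 hx.2.ne).log hh).sub
    (Real.hasDerivAt_log hx0)).congr_deriv ?_
  rw [logMulLogDivEntropy]
  field_simp
  rw [Real.binEntropy, Real.log_inv, Real.log_inv]
  ring

/-- The logarithm of `h (x ^ k) / (x ^ (k - 1) * h x)`. -/
noncomputable def logEntropyRatio (k x : ℝ) : ℝ :=
  (Real.log (Real.binEntropy (x ^ k)) - Real.log (x ^ k)) -
    (Real.log (Real.binEntropy x) - Real.log x)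

theorem rpow_mem_Ioo {k x : ℝ} (hk : 0 < k) (hx : x ∈ Ioo (0 : ℝ) 1) :
    x ^ k ∈ Ioo (0 : ℝ) 1 :=
  ⟨Real.rpow_pos_of_pos hx.1 k, Real.rpow_lt_one hx.1.le hx.2 hk⟩

theorem hasDerivAt_logEntropyRatio {k x : ℝ} (hk : 0 < k) (hx : x ∈ Ioo (0 : ℝ) 1) :
    HasDerivAt (logEntropyRatio k)
      ((logMulLogDivEntropy (x ^ k) - logMulLogDivEntropy x) / (x * Real.log x)) x := by
  have hx0 := hx.1.ne'
  have hl : Real.log x ≠ 0 := (Real.log_neg hx.1 hx.2).ne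
  have hy := rpow_mem_Ioo hk hx
  have hd := (hasDerivAt_log_binEntropy_sub_log hy).comp x
    (Real.hasDerivAt_rpow_const (p := k) (Or.inl hx0))
  refine (hd.sub (hasDerivAt_log_binEntropy_sub_log hx)).congr_deriv ?_
  have hxk : x ^ k = x ^ (k - 1) * x := by
    rw [← Real.rpow_add_one hx0, sub_add_cancel]
  have hpow : x ^ (k - 1) ≠ 0 := (Real.rpow_pos_of_pos hx.1 _).ne'
  rw [Real.log_rpow hx.1]
  generalize logMulLogDivEntropy (x ^ k) = A
  rw [hxk]
  field_simp

/-- On `(0, 1)` the ratio `h (x ^ k) / (x ^ (k - 1) * h x)` is smallest at the point `c`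
with `c ^ k = 1 - c`. -/
theorem logEntropyRatio_ge {k c x : ℝ} (hk : 1 < k) (hc : c ∈ Ioo (0 : ℝ) 1)
    (hck : c ^ k = 1 - c) (hx : x ∈ Ioo (0 : ℝ) 1) :
    logEntropyRatio k c ≤ logEntropyRatio k x := by
  have hk0 : 0 < k := by linarith
  have hle {z : ℝ} (hz : z ∈ Ioo (0 : ℝ) 1) : z ^ k ≤ z := by
    simpa using Real.rpow_le_rpow_of_exponent_ge hz.1 hz.2.le hk.le
  have hneg {z : ℝ} (hz : z ∈ Ioo (0 : ℝ) 1) : z * Real.log z ≤ 0 :=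
    mul_nonpos_of_nonneg_of_nonpos hz.1.le (Real.log_neg hz.1 hz.2).le
  rcases le_total x c with hxc | hcx
  · have hsub : Icc x c ⊆ Ioo (0 : ℝ) 1 := fun z hz =>
      ⟨hx.1.trans_le hz.1, hz.2.trans_lt hc.2⟩
    refine antitoneOn_of_hasDerivWithinAt_nonpos (convex_Icc x c)
      (fun z hz => (hasDerivAt_logEntropyRatio hk0 (hsub hz)).continuousAt.continuousWithinAt)
      (fun z hz => (hasDerivAt_logEntropyRatio hk0
        (hsub (interior_subset hz))).hasDerivWithinAt) (fun z hz => ?_)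
      (left_mem_Icc.2 hxc) (right_mem_Icc.2 hxc) hxc
    have hz' := interior_subset hz
    have hz01 := hsub hz'
    refine div_nonpos_of_nonneg_of_nonpos (sub_nonneg.2 ?_) (hneg hz01)
    refine logMulLogDivEntropy_le_of_mem_segment (rpow_mem_Ioo hk0 hz01) ?_
    have hzk : z ^ k ≤ 1 - z :=
      (Real.rpow_le_rpow hz01.1.le hz'.2 hk0.le).trans (by linarith [hz'.2])
    have := hle hz01
    rw [segment_eq_Icc (by linarith)]
    exact ⟨this, by linarith⟩
  · have hsub : Icc c x ⊆ Ioo (0 : ℝ) 1 := fun z hz =>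
      ⟨hc.1.trans_le hz.1, hz.2.trans_lt hx.2⟩
    refine monotoneOn_of_hasDerivWithinAt_nonneg (convex_Icc c x)
      (fun z hz => (hasDerivAt_logEntropyRatio hk0 (hsub hz)).continuousAt.continuousWithinAt)
      (fun z hz => (hasDerivAt_logEntropyRatio hk0
        (hsub (interior_subset hz))).hasDerivWithinAt) (fun z hz => ?_)
      (left_mem_Icc.2 hcx) (right_mem_Icc.2 hcx) hcx
    have hz' := interior_subset hz
    have hz01 := hsub hz'
    refine div_nonneg_of_nonpos (sub_nonpos.2 ?_) (hneg hz01)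
    refine logMulLogDivEntropy_le_of_mem_segment hz01 ?_
    have hzk : 1 - z ≤ z ^ k :=
      le_trans (by linarith [hz'.1]) (Real.rpow_le_rpow hc.1.le hz'.1 hk0.le)
    have := hle hz01
    rw [segment_symm, segment_eq_Icc (by linarith)]
    exact ⟨hzk, this⟩

/-- For real `k > 1` and `α = α_k` the unique positive solution of
`x (1+x)^(k-1) = 1`, we have `α h(x^k) ≥ x^(k-1) h(x)` for all `0 ≤ x ≤ 1`. -/
theorem alpha_mul_binEntropy_rpow_ge (k α : ℝ) (hk : 1 < k)
    (hα : 0 < α) (hαeq : α * (1 + α) ^ (k - 1) = 1) :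
    ∀ x : ℝ, 0 ≤ x → x ≤ 1 →
      α * binEntropy (x ^ k) ≥ x ^ (k - 1) * binEntropy x := by
  intro x hx0 hx1
  rw [binEntropy_eq_real_binEntropy]
  have hk0 : 0 < k := by linarith
  rcases hx0.eq_or_lt with rfl | hx0
  · simp [Real.zero_rpow hk0.ne']
  rcases hx1.eq_or_lt with rfl | hx1
  · simp
  have hα1 : 0 < 1 + α := by linarith
  have hc : (1 + α)⁻¹ ∈ Ioo (0 : ℝ) 1 := ⟨inv_pos.2 hα1, inv_lt_one_of_one_lt₀ (by linarith)⟩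
  have hck : (1 + α)⁻¹ ^ k = 1 - (1 + α)⁻¹ := by
    have hpow : (1 + α) ^ k = (1 + α) ^ (k - 1) * (1 + α) := by
      rw [← Real.rpow_add_one hα1.ne', sub_add_cancel]
    rw [Real.inv_rpow hα1.le, hpow, mul_inv, inv_eq_of_mul_eq_one_left hαeq]
    field_simp
    ring
  have hmin := logEntropyRatio_ge hk hc hck ⟨hx0, hx1⟩
  have hval : logEntropyRatio k (1 + α)⁻¹ = -Real.log α := by
    have hsub : 1 - (1 + α)⁻¹ = α / (1 + α) := by
      field_simp
      ring
    rw [logEntropyRatio, hck, Real.binEntropy_one_sub, hsub, Real.log_div hα.ne' hα1.ne',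
      Real.log_inv]
    ring
  have hy := rpow_mem_Ioo hk0 ⟨hx0, hx1⟩
  have hhx := Real.binEntropy_pos hx0 hx1
  have hhy := Real.binEntropy_pos hy.1 hy.2
  have hpow : 0 < x ^ (k - 1) := Real.rpow_pos_of_pos hx0 _
  rw [ge_iff_le, ← Real.log_le_log_iff (mul_pos hpow hhx) (mul_pos hα hhy),
    Real.log_mul hpow.ne' hhx.ne', Real.log_mul hα.ne' hhy.ne', Real.log_rpow hx0]
  rw [hval, logEntropyRatio, Real.log_rpow hx0] at hmin
  linarith
end

section
/- Let k > 1 be real and let α_k be the unique positive solution to x(1+x)^{k-1} = 1. For x with 0 ≤ x ≤ 1, equality α_k · h(x^k) = x^{k-1} · h(x) holds if and only if x = 0, x = 1/(1+α_k), or x = 1. -/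
/-- The logarithmic mean of `1` and `u`. -/
noncomputable def logMeanOne (u : ℝ) : ℝ := (u - 1) / Real.log u

theorem hasDerivAt_logMeanOne {u : ℝ} (h0 : 0 < u) (h1 : u < 1) :
    HasDerivAt logMeanOne ((Real.log u - 1 + 1 / u) / Real.log u ^ 2) u := by
  have hl : Real.log u ≠ 0 := (Real.log_neg h0 h1).ne
  refine (((hasDerivAt_id u).sub_const 1).div (Real.hasDerivAt_log h0.ne') hl).congr_deriv ?_
  simp only [id]
  field_simp
  ring

theorem two_mul_one_sub_lt_one_add_mul_neg_log {u : ℝ} (h0 : 0 < u) (h1 : u < 1) :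
    2 * (1 - u) < (1 + u) * -Real.log u := by
  have h := Real.lt_log_one_add_of_pos (sub_pos.2 ((one_lt_inv₀ h0).2 h1))
  have he : 2 * (u⁻¹ - 1) / (u⁻¹ - 1 + 2) = 2 * (1 - u) / (1 + u) := by
    have : u⁻¹ - 1 + 2 = (1 + u) / u := by
      field_simp
      ring
    rw [this]
    field_simp
  rwa [he, add_sub_cancel, Real.log_inv, div_lt_iff₀' (by linarith)] at h

theorem strictAntiOn_deriv_logMeanOne :
    StrictAntiOn (fun u : ℝ => (Real.log u - 1 + 1 / u) / Real.log u ^ 2) (Set.Ioo 0 1) := by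
  have hd : ∀ v ∈ Set.Ioo (0 : ℝ) 1,
      HasDerivAt (fun u : ℝ => (Real.log u - 1 + 1 / u) / Real.log u ^ 2)
        (((1 + v) * -Real.log v - 2 * (1 - v)) / (v ^ 2 * Real.log v ^ 3)) v := by
    rintro v ⟨hv0, hv1⟩
    have hl : Real.log v ≠ 0 := (Real.log_neg hv0 hv1).ne
    have hlog := Real.hasDerivAt_log hv0.ne'
    have hinv : HasDerivAt (fun u : ℝ => 1 / u) (-(v ^ 2)⁻¹) v := by
      simpa only [one_div] using hasDerivAt_inv hv0.ne'
    refine (((hlog.sub_const 1).add hinv).div (hlog.pow 2) (pow_ne_zero 2 hl)).congr_deriv ?_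
    simp only [Pi.add_apply, Pi.pow_apply]
    field_simp
    ring
  refine strictAntiOn_of_deriv_neg (convex_Ioo 0 1)
    (fun v hv => (hd v hv).continuousAt.continuousWithinAt) fun v hv => ?_
  rw [interior_Ioo] at hv
  rw [(hd v hv).deriv]
  have hl := Real.log_neg hv.1 hv.2
  refine div_neg_of_pos_of_neg ?_ (mul_neg_of_pos_of_neg (pow_pos hv.1 2) (Odd.pow_neg (by decide) hl))
  linarith [two_mul_one_sub_lt_one_add_mul_neg_log hv.1 hv.2]

theorem logMeanOne_pos {u : ℝ} (h0 : 0 < u) (h1 : u < 1) : 0 < logMeanOne u :=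
  div_pos_of_neg_of_neg (by linarith) (Real.log_neg h0 h1)

theorem strictMonoOn_logMeanOne_add_one_sub :
    StrictMonoOn (fun x => logMeanOne x + logMeanOne (1 - x)) (Set.Ioc 0 (1 / 2)) := by
  have hd : ∀ v ∈ Set.Ioo (0 : ℝ) 1, HasDerivAt (fun x => logMeanOne x + logMeanOne (1 - x))
      ((Real.log v - 1 + 1 / v) / Real.log v ^ 2 -
        (Real.log (1 - v) - 1 + 1 / (1 - v)) / Real.log (1 - v) ^ 2) v := by
    rintro v ⟨hv0, hv1⟩
    have h1 : HasDerivAt (fun x : ℝ => 1 - x) (-1) v := (hasDerivAt_id v).const_sub 1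
    have h2 := (hasDerivAt_logMeanOne (u := 1 - v) (by linarith) (by linarith)).comp v h1
    refine ((hasDerivAt_logMeanOne hv0 hv1).add h2).congr_deriv ?_
    ring
  refine strictMonoOn_of_deriv_pos (convex_Ioc 0 (1 / 2)) (fun v hv =>
    (hd v ⟨hv.1, by linarith [hv.2]⟩).continuousAt.continuousWithinAt) fun v hv => ?_
  rw [interior_Ioc] at hv
  obtain ⟨hv0, hv1⟩ := hv
  rw [(hd v ⟨hv0, by linarith⟩).deriv]
  have := strictAntiOn_deriv_logMeanOne (a := v) (b := 1 - v) ⟨hv0, by linarith⟩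
    ⟨by linarith, by linarith⟩ (by linarith)
  exact sub_pos.2 this

theorem logMeanOne_add_one_sub_lt {x y : ℝ} (hy : 0 < y) (hyx : y < x) (hyx' : y < 1 - x) :
    logMeanOne y + logMeanOne (1 - y) < logMeanOne x + logMeanOne (1 - x) := by
  rcases le_total x (1 / 2) with h | h
  · exact strictMonoOn_logMeanOne_add_one_sub ⟨hy, by linarith⟩ ⟨by linarith, h⟩ hyx
  · have := strictMonoOn_logMeanOne_add_one_sub (a := y) (b := 1 - x) ⟨hy, by linarith⟩
      ⟨by linarith, by linarith⟩ hyx'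
    simpa only [sub_sub_cancel, add_comm (logMeanOne (1 - x))] using this

theorem binEntropy_one_sub (x : ℝ) : binEntropy (1 - x) = binEntropy x := by
  simp only [binEntropy, sub_sub_cancel]
  ring

theorem binEntropy_pos {x : ℝ} (h0 : 0 < x) (h1 : x < 1) : 0 < binEntropy x := by
  have ha := mul_neg_of_pos_of_neg h0 (Real.log_neg h0 h1)
  have hb := mul_neg_of_pos_of_neg (sub_pos.2 h1) (Real.log_neg (sub_pos.2 h1) (by linarith))
  unfold binEntropy
  linarith

theorem hasDerivAt_log_binEntropy_div {x : ℝ} (h0 : 0 < x) (h1 : x < 1) :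
    HasDerivAt (fun x => Real.log (binEntropy x / x))
      (1 / ((logMeanOne x + logMeanOne (1 - x)) * (x * Real.log x))) x := by
  have hx1 : 0 < 1 - x := sub_pos.2 h1
  have hl : Real.log x ≠ 0 := (Real.log_neg h0 h1).ne
  have hl1 : Real.log (1 - x) ≠ 0 := (Real.log_neg hx1 (by linarith)).ne
  have hs : HasDerivAt (fun x : ℝ => 1 - x) (-1) x := (hasDerivAt_id x).const_sub 1
  have hb : HasDerivAt binEntropy (Real.log (1 - x) - Real.log x) x := by
    refine ((((hasDerivAt_id x).mul (Real.hasDerivAt_log h0.ne')).neg).sub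
      (hs.mul (hs.log hx1.ne'))).congr_deriv ?_
    simp only [id]
    field_simp
    ring
  have hpos := binEntropy_pos h0 h1
  refine ((hb.div (hasDerivAt_id x) h0.ne').log (div_pos hpos h0).ne').congr_deriv ?_
  have hN : logMeanOne x + logMeanOne (1 - x) =
      binEntropy x / (Real.log x * Real.log (1 - x)) := by
    unfold logMeanOne binEntropy
    field_simp
    ring
  have hnum : (Real.log (1 - x) - Real.log x) * x - binEntropy x * 1 = Real.log (1 - x) := by
    unfold binEntropy
    ring
  simp only [id, Pi.div_apply]
  rw [hN, hnum]
  field_simp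

theorem hasDerivAt_log_binEntropy_rpow_div_sub {k x : ℝ} (hk : 1 < k) (h0 : 0 < x) (h1 : x < 1) :
    HasDerivAt (fun x : ℝ => Real.log (binEntropy (x ^ k) / x ^ k) - Real.log (binEntropy x / x))
      ((1 / (logMeanOne (x ^ k) + logMeanOne (1 - x ^ k)) -
        1 / (logMeanOne x + logMeanOne (1 - x))) / (x * Real.log x)) x := by
  have hk0 : 0 < k := by linarith
  have hp : HasDerivAt (fun x : ℝ => x ^ k) (k * x ^ (k - 1)) x :=
    Real.hasDerivAt_rpow_const (Or.inl h0.ne')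
  have hy0 : 0 < x ^ k := Real.rpow_pos_of_pos h0 k
  have hy1 : x ^ k < 1 := Real.rpow_lt_one h0.le h1 hk0
  have hc := (hasDerivAt_log_binEntropy_div hy0 hy1).comp x hp
  refine (hc.sub (hasDerivAt_log_binEntropy_div h0 h1)).congr_deriv ?_
  have hl : Real.log x ≠ 0 := (Real.log_neg h0 h1).ne
  have hN := add_pos (logMeanOne_pos h0 h1)
    (logMeanOne_pos (u := 1 - x) (by linarith) (by linarith))
  have hNk := add_pos (logMeanOne_pos hy0 hy1)
    (logMeanOne_pos (u := 1 - x ^ k) (by linarith) (by linarith))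
  rw [Real.log_rpow h0, Real.rpow_sub_one h0.ne']
  generalize logMeanOne (x ^ k) + logMeanOne (1 - x ^ k) = A at *
  generalize logMeanOne x + logMeanOne (1 - x) = B at *
  generalize x ^ k = y at *
  field_simp

theorem log_binEntropy_rpow_div_sub_lt {k p x : ℝ} (hk : 1 < k) (hp0 : 0 < p) (hp1 : p < 1)
    (hp : p ^ k = 1 - p) (h0 : 0 < x) (h1 : x < 1) (hx : x ≠ p) :
    Real.log (binEntropy (p ^ k) / p ^ k) - Real.log (binEntropy p / p) <
      Real.log (binEntropy (x ^ k) / x ^ k) - Real.log (binEntropy x / x) := by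
  have hk0 : 0 < k := by linarith
  have hpow : ∀ v : ℝ, 0 < v → v < 1 → 0 < v ^ k ∧ v ^ k < v := fun v hv0 hv1 =>
    ⟨Real.rpow_pos_of_pos hv0 k, by
      simpa using Real.rpow_lt_rpow_of_exponent_gt hv0 hv1 hk⟩
  have hN : ∀ v : ℝ, 0 < v → v < 1 → 0 < logMeanOne v + logMeanOne (1 - v) := fun v hv0 hv1 =>
    add_pos (logMeanOne_pos hv0 hv1) (logMeanOne_pos (by linarith) (by linarith))
  rcases lt_or_gt_of_ne hx with hlt | hgt
  · have hanti : StrictAntiOn (fun x : ℝ =>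
        Real.log (binEntropy (x ^ k) / x ^ k) - Real.log (binEntropy x / x)) (Set.Ioc 0 p) := by
      refine strictAntiOn_of_deriv_neg (convex_Ioc 0 p) (fun v hv =>
        (hasDerivAt_log_binEntropy_rpow_div_sub hk hv.1
          (hv.2.trans_lt hp1)).continuousAt.continuousWithinAt) fun v hv => ?_
      rw [interior_Ioc] at hv
      obtain ⟨hv0, hvp⟩ := hv
      have hv1 : v < 1 := hvp.trans hp1
      obtain ⟨hy0, hyv⟩ := hpow v hv0 hv1
      rw [(hasDerivAt_log_binEntropy_rpow_div_sub hk hv0 hv1).deriv]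
      refine div_neg_of_pos_of_neg (sub_pos.2 ?_)
        (mul_neg_of_pos_of_neg hv0 (Real.log_neg hv0 hv1))
      refine one_div_lt_one_div_of_lt (hN _ hy0 (by linarith))
        (logMeanOne_add_one_sub_lt hy0 hyv ?_)
      have := Real.rpow_lt_rpow hv0.le hvp hk0
      linarith
    exact hanti ⟨h0, hlt.le⟩ ⟨hp0, le_rfl⟩ hlt
  · have hmono : StrictMonoOn (fun x : ℝ =>
        Real.log (binEntropy (x ^ k) / x ^ k) - Real.log (binEntropy x / x)) (Set.Ico p 1) := by
      refine strictMonoOn_of_deriv_pos (convex_Ico p 1) (fun v hv =>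
        (hasDerivAt_log_binEntropy_rpow_div_sub hk (hp0.trans_le hv.1)
          hv.2).continuousAt.continuousWithinAt) fun v hv => ?_
      rw [interior_Ico] at hv
      obtain ⟨hpv, hv1⟩ := hv
      have hv0 : 0 < v := hp0.trans hpv
      obtain ⟨hy0, hyv⟩ := hpow v hv0 hv1
      rw [(hasDerivAt_log_binEntropy_rpow_div_sub hk hv0 hv1).deriv]
      refine div_pos_of_neg_of_neg (sub_neg.2 ?_)
        (mul_neg_of_pos_of_neg hv0 (Real.log_neg hv0 hv1))
      refine one_div_lt_one_div_of_lt (hN v hv0 hv1) ?_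
      have := Real.rpow_lt_rpow hp0.le hpv hk0
      have := logMeanOne_add_one_sub_lt (y := 1 - v) (x := v ^ k) (by linarith) (by linarith)
        (by linarith)
      rwa [sub_sub_cancel, add_comm] at this
    exact hmono ⟨le_rfl, hp1⟩ ⟨hgt.le, h1⟩ hgt

/-- For real `k > 1` and `α = α_k` the unique positive solution of
`x (1+x)^(k-1) = 1`, for `0 ≤ x ≤ 1` we have `α h(x^k) = x^(k-1) h(x)`
iff `x = 0`, `x = 1/(1+α)`, or `x = 1`. -/
theorem alpha_mul_binEntropy_rpow_eq_iff (k α : ℝ) (hk : 1 < k)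
    (hα : 0 < α) (hαeq : α * (1 + α) ^ (k - 1) = 1) :
    ∀ x : ℝ, 0 ≤ x → x ≤ 1 →
      (α * binEntropy (x ^ k) = x ^ (k - 1) * binEntropy x ↔
        x = 0 ∨ x = 1 / (1 + α) ∨ x = 1) := by
  intro x hx0 hx1
  have hα1 : 0 < 1 + α := by linarith
  have hk0 : k ≠ 0 := by linarith
  have hp0 : 0 < 1 / (1 + α) := one_div_pos.2 hα1
  have hp1 : 1 / (1 + α) < 1 := (div_lt_one hα1).2 (by linarith)
  have hpα : (1 / (1 + α)) ^ (k - 1) = α := by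
    rw [one_div, Real.inv_rpow hα1.le]
    exact (eq_inv_of_mul_eq_one_left hαeq).symm
  have hpk : (1 / (1 + α)) ^ k = 1 - 1 / (1 + α) := by
    have h := Real.rpow_sub_one hp0.ne' k
    rw [hpα, eq_div_iff hp0.ne'] at h
    rw [← h]
    field_simp
    ring
  have hp : α * binEntropy ((1 / (1 + α)) ^ k) =
      (1 / (1 + α)) ^ (k - 1) * binEntropy (1 / (1 + α)) := by
    rw [hpk, binEntropy_one_sub, hpα]
  have hlog : ∀ v : ℝ, 0 < v → v < 1 → α * binEntropy (v ^ k) = v ^ (k - 1) * binEntropy v →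
      Real.log (binEntropy (v ^ k) / v ^ k) - Real.log (binEntropy v / v) = -Real.log α := by
    intro v hv0 hv1 hv
    have hy0 : 0 < v ^ k := Real.rpow_pos_of_pos hv0 k
    have hb := binEntropy_pos hy0 (Real.rpow_lt_one hv0.le hv1 (by linarith))
    have hv' : binEntropy v / v = α * (binEntropy (v ^ k) / v ^ k) := by
      rw [← mul_div_assoc, hv, Real.rpow_sub_one hv0.ne']
      field_simp
    rw [hv', Real.log_mul hα.ne' (div_pos hb hy0).ne']
    ring
  constructor
  · intro h
    by_contra! hne
    obtain ⟨hn0, hnp, hn1⟩ := hne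
    have h0 := lt_of_le_of_ne hx0 hn0.symm
    have h1 := lt_of_le_of_ne hx1 hn1
    have hlt := log_binEntropy_rpow_div_sub_lt hk hp0 hp1 hpk h0 h1 hnp
    rw [hlog _ hp0 hp1 hp, hlog x h0 h1 h] at hlt
    exact lt_irrefl _ hlt
  · rintro (rfl | rfl | rfl)
    · simp [binEntropy, Real.zero_rpow hk0]
    · exact hp
    · simp [binEntropy]
end

section
/- For all x with 0 ≤ x ≤ 1, h(x^2) ≥ φ·x·h(x), where φ = (1+√5)/2, and equality holds if and only if x = 0, x = 1/φ, or x = 1. -/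
open Set

/-- The difference of the two sides of the inequality. -/
noncomputable def entropyGap (x : ℝ) : ℝ :=
  binEntropy (x ^ 2) - Real.goldenRatio * x * binEntropy x

/-- The derivative of `entropyGap` on `(0, 1)`, written so that it is continuous at `0`. -/
noncomputable def entropyGapDeriv (x : ℝ) : ℝ :=
  2 * (x * Real.log (1 - x ^ 2)) - 4 * (x * Real.log x) - Real.goldenRatio * binEntropy x
    - Real.goldenRatio * (x * Real.log (1 - x)) + Real.goldenRatio * (x * Real.log x)

/-- The second derivative of `entropyGap` on `(0, 1)`. -/
noncomputable def entropyGapDeriv2 (x : ℝ) : ℝ :=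
  2 * Real.log (1 - x ^ 2) - 4 * Real.log x - 4 / (1 - x ^ 2)
    - Real.goldenRatio * (2 * Real.log (1 - x) - 2 * Real.log x - 1 / (1 - x))

theorem continuous_binEntropy : Continuous binEntropy := by
  have h : binEntropy = fun x => -(x * Real.log x) - (1 - x) * Real.log (1 - x) := rfl
  rw [h]
  exact Real.continuous_mul_log.neg.sub
    (Real.continuous_mul_log.comp (continuous_const.sub continuous_id))

theorem hasDerivAt_binEntropy {x : ℝ} (h0 : 0 < x) (h1 : x < 1) :
    HasDerivAt binEntropy (Real.log (1 - x) - Real.log x) x := by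
  have hy : 1 - x ≠ 0 := by linarith
  have hsub : HasDerivAt (fun y : ℝ => 1 - y) (-1) x := by
    simpa using (hasDerivAt_id x).const_sub 1
  refine (((Real.hasDerivAt_mul_log h0.ne').neg).sub
    ((Real.hasDerivAt_mul_log hy).comp x hsub)).congr_deriv ?_
  ring

theorem continuous_entropyGap : Continuous entropyGap := by
  unfold entropyGap
  have := continuous_binEntropy
  fun_prop

theorem hasDerivAt_entropyGap {x : ℝ} (h0 : 0 < x) (h1 : x < 1) :
    HasDerivAt entropyGap (entropyGapDeriv x) x := by
  have hsq : HasDerivAt (fun y : ℝ => y ^ 2) (2 * x) x := by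
    simpa using hasDerivAt_pow 2 x
  have hcomp : HasDerivAt (fun y : ℝ => binEntropy (y ^ 2))
      ((Real.log (1 - x ^ 2) - Real.log (x ^ 2)) * (2 * x)) x :=
    HasDerivAt.comp (h := fun y : ℝ => y ^ 2) x
      (hasDerivAt_binEntropy (by positivity) (by nlinarith)) hsq
  have hlin : HasDerivAt (fun y : ℝ => Real.goldenRatio * y) Real.goldenRatio x := by
    simpa using (hasDerivAt_id x).const_mul Real.goldenRatio
  refine (hcomp.sub (hlin.mul (hasDerivAt_binEntropy h0 h1))).congr_deriv ?_
  rw [entropyGapDeriv, Real.log_pow]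
  push_cast
  ring

theorem continuousOn_entropyGapDeriv : ContinuousOn entropyGapDeriv (Ico 0 1) := by
  intro x hx
  have hy : 1 - x ≠ 0 := by linarith [hx.2]
  have hz : 1 - x ^ 2 ≠ 0 := by nlinarith [hx.1, hx.2]
  have hb := continuous_binEntropy.continuousAt (x := x)
  have hm := Real.continuous_mul_log.continuousAt (x := x)
  have hly : ContinuousAt (fun x : ℝ => Real.log (1 - x)) x :=
    ContinuousAt.log (by fun_prop) hy
  have hlz : ContinuousAt (fun x : ℝ => Real.log (1 - x ^ 2)) x :=
    ContinuousAt.log (by fun_prop) hz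
  unfold entropyGapDeriv
  exact ContinuousAt.continuousWithinAt (by fun_prop)

theorem hasDerivAt_log_one_sub {x : ℝ} (h1 : x < 1) :
    HasDerivAt (fun y : ℝ => Real.log (1 - y)) (-1 / (1 - x)) x :=
  ((hasDerivAt_id x).const_sub 1).log (by simpa using (sub_pos.2 h1).ne')

theorem hasDerivAt_one_sub_sq (x : ℝ) :
    HasDerivAt (fun y : ℝ => 1 - y ^ 2) (-(2 * x)) x := by
  simpa using (hasDerivAt_pow 2 x).const_sub 1

theorem hasDerivAt_entropyGapDeriv {x : ℝ} (h0 : 0 < x) (h1 : x < 1) :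
    HasDerivAt entropyGapDeriv (entropyGapDeriv2 x) x := by
  have hy : 1 - x ≠ 0 := by linarith
  have hz : 1 - x ^ 2 ≠ 0 := by nlinarith
  have hm := Real.hasDerivAt_mul_log h0.ne'
  refine (((((((hasDerivAt_id x).mul ((hasDerivAt_one_sub_sq x).log hz)).const_mul 2).sub
    (hm.const_mul 4)).sub
    ((hasDerivAt_binEntropy h0 h1).const_mul Real.goldenRatio)).sub
    (((hasDerivAt_id x).mul (hasDerivAt_log_one_sub h1)).const_mul Real.goldenRatio)).add
    (hm.const_mul Real.goldenRatio)).congr_deriv ?_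
  simp only [entropyGapDeriv2, id]
  field_simp
  ring

theorem hasDerivAt_entropyGapDeriv2 {x : ℝ} (h0 : 0 < x) (h1 : x < 1) :
    HasDerivAt entropyGapDeriv2
      ((Real.goldenRatio * (2 + 3 * x - x ^ 3) - 4 - 4 * x ^ 2) / (x * (1 - x ^ 2) ^ 2)) x := by
  have hy : 1 - x ≠ 0 := by linarith
  have hw : 1 + x ≠ 0 := by linarith
  have hz : 1 - x ^ 2 ≠ 0 := by nlinarith
  have hlog := Real.hasDerivAt_log h0.ne'
  have hly := hasDerivAt_log_one_sub h1
  have hsq := hasDerivAt_one_sub_sq x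
  have hsub : HasDerivAt (fun y : ℝ => 1 - y) (-1) x := by
    simpa using (hasDerivAt_id x).const_sub 1
  refine (((((hsq.log hz).const_mul 2).sub (hlog.const_mul 4)).sub
    ((hasDerivAt_const x (4 : ℝ)).div hsq hz)).sub
    ((((hly.const_mul 2).sub (hlog.const_mul 2)).sub
    ((hasDerivAt_const x (1 : ℝ)).div hsub hy)).const_mul Real.goldenRatio)).congr_deriv ?_
  rw [show 1 - x ^ 2 = (1 - x) * (1 + x) by ring]
  field_simp
  ring

/-- The numerator of the third derivative of `entropyGap` is strictly concave on `(0, ∞)`, hence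
has no three zeros there. -/
theorem cubic_not_three_zeros {k a b c : ℝ} (hk : 0 < k) (ha : 0 < a) (hab : a < b) (hbc : b < c)
    (pa : k * (2 + 3 * a - a ^ 3) - 4 - 4 * a ^ 2 = 0)
    (pb : k * (2 + 3 * b - b ^ 3) - 4 - 4 * b ^ 2 = 0)
    (pc : k * (2 + 3 * c - c ^ 3) - 4 - 4 * c ^ 2 = 0) : False := by
  have e1 : k * (3 - (a ^ 2 + a * b + b ^ 2)) - 4 * (a + b) = 0 :=
    mul_left_cancel₀ (sub_ne_zero.2 hab.ne) (by linear_combination pa - pb)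
  have e2 : k * (3 - (b ^ 2 + b * c + c ^ 2)) - 4 * (b + c) = 0 :=
    mul_left_cancel₀ (sub_ne_zero.2 hbc.ne) (by linear_combination pb - pc)
  have e3 : k * (a + b + c) + 4 = 0 :=
    mul_left_cancel₀ (sub_ne_zero.2 (hab.trans hbc).ne) (by linear_combination e2 - e1)
  have : 0 < k * (a + b + c) := mul_pos hk (by linarith)
  linarith

theorem exists_entropyGapDeriv_eq_zero {a b : ℝ} (ha : 0 ≤ a) (hb : b ≤ 1) (hab : a < b)
    (fa : entropyGap a = 0) (fb : entropyGap b = 0) :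
    ∃ c ∈ Ioo a b, entropyGapDeriv c = 0 :=
  exists_hasDerivAt_eq_zero hab continuous_entropyGap.continuousOn (fa.trans fb.symm)
    fun _ hx => hasDerivAt_entropyGap (ha.trans_lt hx.1) (hx.2.trans_le hb)

theorem exists_entropyGapDeriv2_eq_zero {a b : ℝ} (ha : 0 ≤ a) (hb : b < 1) (hab : a < b)
    (fa : entropyGapDeriv a = 0) (fb : entropyGapDeriv b = 0) :
    ∃ c ∈ Ioo a b, entropyGapDeriv2 c = 0 :=
  exists_hasDerivAt_eq_zero hab
    (continuousOn_entropyGapDeriv.mono fun _ hx => ⟨ha.trans hx.1, hx.2.trans_lt hb⟩)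
    (fa.trans fb.symm)
    fun _ hx => hasDerivAt_entropyGapDeriv (ha.trans_lt hx.1) (hx.2.trans hb)

theorem exists_cubic_eq_zero {a b : ℝ} (ha : 0 < a) (hb : b < 1) (hab : a < b)
    (fa : entropyGapDeriv2 a = 0) (fb : entropyGapDeriv2 b = 0) :
    ∃ c ∈ Ioo a b, Real.goldenRatio * (2 + 3 * c - c ^ 3) - 4 - 4 * c ^ 2 = 0 := by
  obtain ⟨c, hc, h⟩ := exists_hasDerivAt_eq_zero hab
    (fun x hx => (hasDerivAt_entropyGapDeriv2 (ha.trans_le hx.1)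
      (hx.2.trans_lt hb)).continuousAt.continuousWithinAt) (fa.trans fb.symm)
    fun x hx => hasDerivAt_entropyGapDeriv2 (ha.trans hx.1) (hx.2.trans hb)
  have h0 : 0 < c := ha.trans hc.1
  have hz : 1 - c ^ 2 ≠ 0 := by nlinarith [hc.2]
  exact ⟨c, hc, (div_eq_zero_iff.1 h).resolve_right (by positivity)⟩

theorem entropyGapDeriv_zero : entropyGapDeriv 0 = 0 := by
  simp [entropyGapDeriv, binEntropy]

theorem entropyGapDeriv_not_four_pos_zeros {p q r s : ℝ} (hp : 0 < p) (hpq : p < q) (hqr : q < r)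
    (hrs : r < s) (hs : s < 1) (zp : entropyGapDeriv p = 0) (zq : entropyGapDeriv q = 0)
    (zr : entropyGapDeriv r = 0) (zs : entropyGapDeriv s = 0) : False := by
  obtain ⟨a, ⟨ha, ha'⟩, za⟩ :=
    exists_entropyGapDeriv2_eq_zero le_rfl (by linarith) hp entropyGapDeriv_zero zp
  obtain ⟨b, ⟨hb, hb'⟩, zb⟩ :=
    exists_entropyGapDeriv2_eq_zero (by linarith) (by linarith) hpq zp zq
  obtain ⟨c, ⟨hc, hc'⟩, zc⟩ :=
    exists_entropyGapDeriv2_eq_zero (by linarith) (by linarith) hqr zq zr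
  obtain ⟨d, ⟨hd, hd'⟩, zd⟩ :=
    exists_entropyGapDeriv2_eq_zero (by linarith) (by linarith) hrs zr zs
  obtain ⟨u, ⟨hu, hu'⟩, zu⟩ :=
    exists_cubic_eq_zero (by linarith) (by linarith) (by linarith : a < b) za zb
  obtain ⟨v, ⟨hv, hv'⟩, zv⟩ :=
    exists_cubic_eq_zero (by linarith) (by linarith) (by linarith : b < c) zb zc
  obtain ⟨w, ⟨hw, hw'⟩, zw⟩ :=
    exists_cubic_eq_zero (by linarith) (by linarith) (by linarith : c < d) zc zd
  exact cubic_not_three_zeros Real.goldenRatio_pos (by linarith : 0 < u) (by linarith)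
    (by linarith) zu zv zw

theorem inv_goldenRatio_sq : Real.goldenRatio⁻¹ ^ 2 = 1 - Real.goldenRatio⁻¹ := by
  have h := Real.goldenRatio_ne_zero
  have hsq := Real.goldenRatio_sq
  generalize Real.goldenRatio = k at h hsq ⊢
  field_simp
  linear_combination -hsq

theorem entropyGap_zero : entropyGap 0 = 0 := by simp [entropyGap, binEntropy]

theorem entropyGap_one : entropyGap 1 = 0 := by simp [entropyGap, binEntropy]

theorem entropyGap_inv_goldenRatio : entropyGap Real.goldenRatio⁻¹ = 0 := by
  rw [entropyGap, inv_goldenRatio_sq, mul_inv_cancel₀ Real.goldenRatio_ne_zero]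
  simp only [binEntropy, sub_sub_cancel]
  ring

theorem entropyGapDeriv_inv_goldenRatio : entropyGapDeriv Real.goldenRatio⁻¹ = 0 := by
  have hc := inv_goldenRatio_sq
  have hl : Real.log (1 - Real.goldenRatio⁻¹) = 2 * Real.log Real.goldenRatio⁻¹ := by
    rw [← hc, Real.log_pow]
    push_cast
    rfl
  have hmul := mul_inv_cancel₀ Real.goldenRatio_ne_zero
  have hsq := Real.goldenRatio_sq
  rw [entropyGapDeriv, binEntropy, hc, sub_sub_cancel, hl]
  generalize Real.goldenRatio⁻¹ = i at hmul ⊢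
  generalize Real.goldenRatio = k at hmul hsq ⊢
  have hadd : k = 1 + i := by linear_combination i * hsq - (k - 1) * hmul
  linear_combination 2 * Real.log i * hadd - 2 * Real.log i * hmul

theorem entropyGap_ne_zero {x : ℝ} (h0 : 0 < x) (h1 : x < 1) (hx : x ≠ Real.goldenRatio⁻¹) :
    entropyGap x ≠ 0 := by
  intro hzero
  have hc0 : 0 < Real.goldenRatio⁻¹ := inv_pos.2 Real.goldenRatio_pos
  have hc1 : Real.goldenRatio⁻¹ < 1 := inv_lt_one_of_one_lt₀ Real.one_lt_goldenRatio
  rcases hx.lt_or_gt with hlt | hgt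
  · obtain ⟨p, ⟨hp, hp'⟩, zp⟩ :=
      exists_entropyGapDeriv_eq_zero le_rfl h1.le h0 entropyGap_zero hzero
    obtain ⟨q, ⟨hq, hq'⟩, zq⟩ :=
      exists_entropyGapDeriv_eq_zero h0.le hc1.le hlt hzero entropyGap_inv_goldenRatio
    obtain ⟨s, ⟨hs, hs'⟩, zs⟩ :=
      exists_entropyGapDeriv_eq_zero hc0.le le_rfl hc1 entropyGap_inv_goldenRatio entropyGap_one
    exact entropyGapDeriv_not_four_pos_zeros hp (hp'.trans hq) hq' hs hs' zp zq
      entropyGapDeriv_inv_goldenRatio zs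
  · obtain ⟨p, ⟨hp, hp'⟩, zp⟩ :=
      exists_entropyGapDeriv_eq_zero le_rfl hc1.le hc0 entropyGap_zero entropyGap_inv_goldenRatio
    obtain ⟨r, ⟨hr, hr'⟩, zr⟩ :=
      exists_entropyGapDeriv_eq_zero hc0.le h1.le hgt entropyGap_inv_goldenRatio hzero
    obtain ⟨s, ⟨hs, hs'⟩, zs⟩ :=
      exists_entropyGapDeriv_eq_zero h0.le le_rfl h1 hzero entropyGap_one
    exact entropyGapDeriv_not_four_pos_zeros hp hp' hr (hr'.trans hs) hs' zp
      entropyGapDeriv_inv_goldenRatio zr zs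

theorem goldenRatio_lt : Real.goldenRatio < 1.61804 := by
  have h : √5 < 2.23608 := (Real.sqrt_lt' (by norm_num)).2 (by norm_num)
  rw [Real.goldenRatio]
  linarith

theorem lt_goldenRatio : 1.61803 < Real.goldenRatio := by
  have h : 2.23606 < √5 := Real.lt_sqrt_of_sq_lt (by norm_num)
  rw [Real.goldenRatio]
  linarith

theorem log_three_lt : 29 * Real.log 3 < 46 * Real.log 2 := by
  have h := Real.log_lt_log (by norm_num) (by norm_num : (3 : ℝ) ^ 29 < 2 ^ 46)
  rw [Real.log_pow, Real.log_pow] at h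
  exact_mod_cast h

theorem lt_log_five : 51 * Real.log 2 < 22 * Real.log 5 := by
  have h := Real.log_lt_log (by norm_num) (by norm_num : (2 : ℝ) ^ 51 < 5 ^ 22)
  rw [Real.log_pow, Real.log_pow] at h
  exact_mod_cast h

theorem entropyGap_half_pos : 0 < entropyGap (1 / 2) := by
  have h2 : 0 < Real.log 2 := Real.log_pos (by norm_num)
  have e1 : Real.log (1 / 2) = -Real.log 2 := by rw [one_div, Real.log_inv]
  have e2 : Real.log ((1 / 2) ^ 2) = -(2 * Real.log 2) := by
    rw [Real.log_pow, e1]; push_cast; ring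
  have e3 : Real.log (1 - (1 / 2) ^ 2) = Real.log 3 - 2 * Real.log 2 := by
    rw [show (1 : ℝ) - (1 / 2) ^ 2 = 3 / 2 ^ 2 by norm_num,
      Real.log_div (by norm_num) (by norm_num), Real.log_pow]
    norm_num
  have e4 : Real.log (1 - 1 / 2) = -Real.log 2 := by rw [← e1]; norm_num
  rw [entropyGap, binEntropy, binEntropy, e1, e2, e3, e4]
  nlinarith [mul_pos h2 (sub_pos.2 goldenRatio_lt), log_three_lt]

theorem entropyGap_four_fifths_pos : 0 < entropyGap (4 / 5) := by
  have h2 : 0 < Real.log 2 := Real.log_pos (by norm_num)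
  have e1 : Real.log (4 / 5) = 2 * Real.log 2 - Real.log 5 := by
    rw [show (4 : ℝ) / 5 = 2 ^ 2 / 5 by norm_num,
      Real.log_div (by norm_num) (by norm_num), Real.log_pow]
    norm_num
  have e2 : Real.log ((4 / 5) ^ 2) = 2 * (2 * Real.log 2 - Real.log 5) := by
    rw [Real.log_pow, e1]; push_cast; ring
  have e3 : Real.log (1 - (4 / 5) ^ 2) = 2 * (Real.log 3 - Real.log 5) := by
    rw [show (1 : ℝ) - (4 / 5) ^ 2 = (3 / 5) ^ 2 by norm_num, Real.log_pow,
      Real.log_div (by norm_num) (by norm_num)]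
    norm_num
  have e4 : Real.log (1 - 4 / 5) = -Real.log 5 := by
    rw [show (1 : ℝ) - 4 / 5 = 5⁻¹ by norm_num, Real.log_inv]
  have hpos : 0 < Real.log 5 - 8 / 5 * Real.log 2 := by linarith [lt_log_five]
  rw [entropyGap, binEntropy, binEntropy, e1, e2, e3, e4]
  nlinarith [mul_pos hpos (sub_pos.2 goldenRatio_lt), log_three_lt, lt_log_five]

theorem entropyGap_pos {x : ℝ} (h0 : 0 < x) (h1 : x < 1) (hx : x ≠ Real.goldenRatio⁻¹) :
    0 < entropyGap x := by
  have hchalf : 1 / 2 < Real.goldenRatio⁻¹ := by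
    rw [one_div]
    exact inv_strictAnti₀ Real.goldenRatio_pos Real.goldenRatio_lt_two
  have hcfour : Real.goldenRatio⁻¹ < 4 / 5 := by
    rw [show (4 : ℝ) / 5 = (5 / 4)⁻¹ by norm_num]
    exact inv_strictAnti₀ (by norm_num) (by linarith [lt_goldenRatio])
  by_contra! hneg
  have key {y : ℝ} (hy : 0 < entropyGap y)
      (hne : ∀ z ∈ uIcc x y, entropyGap z ≠ 0) : False := by
    obtain ⟨z, hz, hzero⟩ := intermediate_value_uIcc (a := x) (b := y)
      continuous_entropyGap.continuousOn (mem_uIcc.2 (Or.inl ⟨hneg, hy.le⟩))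
    exact hne z hz hzero
  rcases hx.lt_or_gt with hlt | hgt
  · refine key entropyGap_half_pos fun z hz => ?_
    have hz1 : 0 < z := (lt_min h0 (by norm_num)).trans_le hz.1
    have hz2 : z < Real.goldenRatio⁻¹ := hz.2.trans_lt (max_lt hlt hchalf)
    exact entropyGap_ne_zero hz1 (by linarith) hz2.ne
  · refine key entropyGap_four_fifths_pos fun z hz => ?_
    have hz1 : Real.goldenRatio⁻¹ < z := (lt_min hgt hcfour).trans_le hz.1
    have hz2 : z < 1 := hz.2.trans_lt (max_lt h1 (by norm_num))
    exact entropyGap_ne_zero (by linarith) hz2 hz1.ne'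

/-- Boppana's entropy inequality: `h(x^2) ≥ φ x h(x)` on `[0,1]`, where
`φ = (1+√5)/2`, with equality iff `x = 0`, `x = 1/φ`, or `x = 1`. -/
theorem boppana_entropy_inequality :
    ∀ x : ℝ, 0 ≤ x → x ≤ 1 →
      binEntropy (x ^ 2) ≥ (1 + Real.sqrt 5) / 2 * x * binEntropy x ∧
      (binEntropy (x ^ 2) = (1 + Real.sqrt 5) / 2 * x * binEntropy x ↔
        x = 0 ∨ x = 1 / ((1 + Real.sqrt 5) / 2) ∨ x = 1) := by
  intro x h0 h1
  have hphi : (1 + Real.sqrt 5) / 2 = Real.goldenRatio := rfl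
  rw [hphi, one_div, ge_iff_le, ← sub_nonneg, ← sub_eq_zero]
  change 0 ≤ entropyGap x ∧ (entropyGap x = 0 ↔ _)
  rcases h0.eq_or_lt with rfl | h0
  · simp [entropyGap_zero]
  rcases h1.eq_or_lt with rfl | h1
  · simp [entropyGap_one]
  by_cases hx : x = Real.goldenRatio⁻¹
  · subst hx
    exact ⟨entropyGap_inv_goldenRatio.ge, iff_of_true entropyGap_inv_goldenRatio (.inr (.inl rfl))⟩
  · have hpos := entropyGap_pos h0 h1 hx
    exact ⟨hpos.le, iff_of_false hpos.ne' (not_or.2 ⟨h0.ne', not_or.2 ⟨hx, h1.ne⟩⟩)⟩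
end

section
/- Let k > 1 be real. Define q(x) = x^{k-1} h(x) / h(x^k) for 0 < x < 1. Then the limit of q(x) as x → 1⁻ equals 1/k. -/
open Filter Topology

theorem tendsto_log_one_sub_atBot :
    Tendsto (fun x : ℝ => Real.log (1 - x)) (𝓝[Set.Ioo (0 : ℝ) 1] 1) atBot := by
  refine Real.tendsto_log_nhdsGT_zero.comp (tendsto_nhdsWithin_iff.2 ⟨?_, ?_⟩)
  · have h : Tendsto (fun x : ℝ => 1 - x) (𝓝 1) (𝓝 (1 - 1)) := tendsto_id.const_sub 1
    rw [sub_self] at h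
    exact h.mono_left nhdsWithin_le_nhds
  · filter_upwards [self_mem_nhdsWithin] with x hx
    exact sub_pos.2 hx.2

theorem HasDerivAt.tendsto_slope_Ioo_zero_one {f : ℝ → ℝ} {f' : ℝ} (h : HasDerivAt f f' 1) :
    Tendsto (fun x => (f 1 - f x) / (1 - x)) (𝓝[Set.Ioo (0 : ℝ) 1] 1) (𝓝 f') := by
  have hs := (hasDerivAt_iff_tendsto_slope.1 h).mono_left
    (nhdsWithin_mono 1 fun x (hx : x ∈ Set.Ioo (0 : ℝ) 1) => hx.2.ne)
  refine hs.congr fun x => ?_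
  rw [slope_def_field, ← neg_sub (f 1), ← neg_sub 1 x, neg_div_neg_eq]

theorem tendsto_binEntropy_div_one_sub_mul_log :
    Tendsto (fun x => binEntropy x / ((1 - x) * Real.log (1 - x)))
      (𝓝[Set.Ioo (0 : ℝ) 1] 1) (𝓝 (-1)) := by
  have hlog := (Real.hasDerivAt_log one_ne_zero).tendsto_slope_Ioo_zero_one
  have hid : Tendsto (fun x : ℝ => x) (𝓝[Set.Ioo (0 : ℝ) 1] 1) (𝓝 1) := nhdsWithin_le_nhds
  have h := ((hid.mul hlog).mul tendsto_log_one_sub_atBot.inv_tendsto_atBot).sub_const 1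
  simp only [mul_zero, zero_sub] at h
  refine h.congr' ?_
  filter_upwards [self_mem_nhdsWithin] with x ⟨hx₀, hx₁⟩
  have h₁ : 1 - x ≠ 0 := (sub_pos.2 hx₁).ne'
  have h₂ : Real.log (1 - x) ≠ 0 := (Real.log_neg (sub_pos.2 hx₁) (by linarith)).ne
  simp only [binEntropy, Pi.inv_apply, Real.log_one]
  field_simp
  ring

theorem tendsto_rpow_Ioo_zero_one {k : ℝ} (hk : 0 < k) :
    Tendsto (fun x : ℝ => x ^ k) (𝓝[Set.Ioo (0 : ℝ) 1] 1) (𝓝[Set.Ioo (0 : ℝ) 1] 1) := by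
  refine tendsto_nhdsWithin_iff.2 ⟨?_, ?_⟩
  · have h := (Real.continuousAt_rpow_const 1 k (Or.inl one_ne_zero)).tendsto
    rw [Real.one_rpow] at h
    exact h.mono_left nhdsWithin_le_nhds
  · filter_upwards [self_mem_nhdsWithin] with x hx
    exact ⟨Real.rpow_pos_of_pos hx.1 k, Real.rpow_lt_one hx.1.le hx.2 hk⟩

/-- For real `k > 1`, the function `q(x) = x^(k-1) h(x) / h(x^k)` tends to
`1/k` as `x → 1⁻` within `(0,1)`. -/
theorem q_tendsto_one (k : ℝ) (hk : 1 < k) :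
    Tendsto (fun x : ℝ => x ^ (k - 1) * binEntropy x / binEntropy (x ^ k))
      (𝓝[Set.Ioo (0 : ℝ) 1] 1) (𝓝 (1 / k)) := by
  have hk₀ : 0 < k := by linarith
  have hr : Tendsto (fun x : ℝ => (1 - x ^ k) / (1 - x)) (𝓝[Set.Ioo (0 : ℝ) 1] 1) (𝓝 k) := by
    simpa using (Real.hasDerivAt_rpow_const (x := 1) (p := k)
      (Or.inl one_ne_zero)).tendsto_slope_Ioo_zero_one
  have hl : Tendsto (fun x : ℝ => Real.log (1 - x ^ k) / Real.log (1 - x))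
      (𝓝[Set.Ioo (0 : ℝ) 1] 1) (𝓝 1) := by
    have h := ((hr.log hk₀.ne').mul tendsto_log_one_sub_atBot.inv_tendsto_atBot).const_add 1
    simp only [mul_zero, add_zero] at h
    refine h.congr' ?_
    filter_upwards [self_mem_nhdsWithin] with x ⟨hx₀, hx₁⟩
    have h₁ : 1 - x ≠ 0 := (sub_pos.2 hx₁).ne'
    have h₂ : Real.log (1 - x) ≠ 0 := (Real.log_neg (sub_pos.2 hx₁) (by linarith)).ne
    have h₃ : 1 - x ^ k ≠ 0 := (sub_pos.2 (Real.rpow_lt_one hx₀.le hx₁ hk₀)).ne'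
    rw [Real.log_div h₃ h₁, Pi.inv_apply]
    field_simp
    ring
  have hp := (tendsto_rpow_Ioo_zero_one (sub_pos.2 hk)).mono_right nhdsWithin_le_nhds
  have hg := tendsto_binEntropy_div_one_sub_mul_log
  have hgk := hg.comp (tendsto_rpow_Ioo_zero_one hk₀)
  have h := (hp.mul hg).div (hgk.mul (hr.mul hl)) (by simpa using hk₀.ne')
  have hlim : 1 * (-1) / (-1 * (k * 1)) = 1 / k := by field_simp
  rw [hlim] at h
  refine h.congr' ?_
  filter_upwards [self_mem_nhdsWithin] with x ⟨hx₀, hx₁⟩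
  have hxk₀ : 0 < x ^ k := Real.rpow_pos_of_pos hx₀ k
  have hxk₁ : x ^ k < 1 := Real.rpow_lt_one hx₀.le hx₁ hk₀
  have h₁ : 1 - x ≠ 0 := (sub_pos.2 hx₁).ne'
  have h₂ : Real.log (1 - x) ≠ 0 := (Real.log_neg (sub_pos.2 hx₁) (by linarith)).ne
  have h₃ : 1 - x ^ k ≠ 0 := (sub_pos.2 hxk₁).ne'
  have h₄ : Real.log (1 - x ^ k) ≠ 0 := (Real.log_neg (sub_pos.2 hxk₁) (by linarith)).ne
  simp only [Function.comp_apply, Pi.div_apply]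
  field_simp
end

section
/- Let k > 1 be real and let α_k be the unique positive solution to x(1+x)^{k-1} = 1. Then α_k > 1/k. -/
/-- For real `k > 1`, the unique positive solution `α` of
`x (1+x)^(k-1) = 1` satisfies `α > 1/k`. -/
theorem alpha_gt_one_div (k α : ℝ) (hk : 1 < k)
    (hα : 0 < α) (hαeq : α * (1 + α) ^ (k - 1) = 1) :
    α > 1 / k := by
  have h1 : 0 < 1 + α := by linarith
  have hlog : Real.log α + (k - 1) * Real.log (1 + α) = 0 := by
    rw [← Real.log_rpow h1, ← Real.log_mul hα.ne' (Real.rpow_pos_of_pos h1 _).ne', hαeq,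
      Real.log_one]
  have hlt : Real.log (1 + α) < 1 + α - 1 := Real.log_lt_sub_one_of_pos h1 (by linarith)
  have hle : Real.log α ≤ α - 1 := Real.log_le_sub_one_of_pos hα
  have hmul := mul_lt_mul_of_pos_left hlt (sub_pos.mpr hk)
  rw [gt_iff_lt, div_lt_iff₀ (by linarith)]
  linarith
end

section
/- Define U(x) = log(x)·log(1-x)/h(x) for 0 < x < 1, where h is the binary entropy function. Then U is strictly decreasing on the interval (0, 1/2]. -/
/-- A strictly concave function `f` on a set `s` satisfies `f x + f (c - x) < f y + f (c - y)`
whenever `y` lies strictly between `x` and `c - x`. -/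
theorem StrictConcaveOn.add_reflect_lt {s : Set ℝ} {f : ℝ → ℝ} (hf : StrictConcaveOn ℝ s f)
    {c x y : ℝ} (hx : x ∈ s) (hcx : c - x ∈ s) (hxy : x < y) (hyx : y < c - x) :
    f x + f (c - x) < f y + f (c - y) := by
  have hd : 0 < c - x - x := by linarith
  have ha : 0 < (c - x - y) / (c - x - x) := div_pos (by linarith) hd
  have hb : 0 < (y - x) / (c - x - x) := div_pos (by linarith) hd
  have hab : (c - x - y) / (c - x - x) + (y - x) / (c - x - x) = 1 := by
    field_simp; ring
  have hne : x ≠ c - x := by linarith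
  have h₁ := hf.2 hx hcx hne ha hb hab
  have h₂ := hf.2 hx hcx hne hb ha (by rw [add_comm]; exact hab)
  have e₁ : ((c - x - y) / (c - x - x)) • x + ((y - x) / (c - x - x)) • (c - x) = y := by
    simp only [smul_eq_mul]; field_simp; ring
  have e₂ : ((y - x) / (c - x - x)) • x + ((c - x - y) / (c - x - x)) • (c - x) = c - y := by
    simp only [smul_eq_mul]; field_simp; ring
  rw [e₁] at h₁
  rw [e₂] at h₂
  simp only [smul_eq_mul] at h₁ h₂
  linear_combination h₁ + h₂ - (f x + f (c - x)) * hab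

/-- The logarithmic mean of `u` and `1` as an integral of powers of `u`. -/
theorem integral_const_rpow_zero_one {u : ℝ} (hu : 0 < u) (hu' : u ≠ 1) :
    ∫ t in (0 : ℝ)..1, u ^ t = (u - 1) / Real.log u := by
  have hl : Real.log u ≠ 0 := Real.log_ne_zero_of_pos_of_ne_one hu hu'
  simp only [Real.rpow_def_of_pos hu]
  rw [intervalIntegral.integral_comp_mul_left (fun t => Real.exp t) hl, integral_exp]
  simp [Real.exp_log hu, div_eq_inv_mul]

/-- The reciprocal of `log x * log (1 - x) / binEntropy x` as an integral. -/
theorem log_mul_log_div_binEntropy_eq_inv_integral {x : ℝ} (h₀ : 0 < x) (h₁ : x < 1) :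
    Real.log x * Real.log (1 - x) / binEntropy x =
      (∫ t in (0 : ℝ)..1, (x ^ t + (1 - x) ^ t))⁻¹ := by
  have hx : 0 < 1 - x := by linarith
  have hl₀ : Real.log x ≠ 0 := (Real.log_neg h₀ h₁).ne
  have hl₁ : Real.log (1 - x) ≠ 0 := (Real.log_neg hx (by linarith)).ne
  rw [intervalIntegral.integral_add
      ((Real.continuous_const_rpow h₀.ne').intervalIntegrable _ _)
      ((Real.continuous_const_rpow hx.ne').intervalIntegrable _ _),
    integral_const_rpow_zero_one h₀ h₁.ne, integral_const_rpow_zero_one hx (by linarith),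
    div_add_div _ _ hl₀ hl₁, inv_div]
  congr 1
  rw [binEntropy]
  ring

/-- `U(x) = log(x) log(1-x) / h(x)` is strictly decreasing on `(0, 1/2]`. -/
theorem U_strictAntiOn :
    StrictAntiOn (fun x : ℝ => Real.log x * Real.log (1 - x) / binEntropy x)
      (Set.Ioc 0 (1 / 2)) := by
  rintro x ⟨hx₀, hx⟩ y ⟨hy₀, hy⟩ hxy
  have hx' : 0 < 1 - x := by linarith
  have hy' : 0 < 1 - y := by linarith
  have hcont {z : ℝ} (h₀ : 0 < z) (h₁ : 0 < 1 - z) :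
      Continuous fun t : ℝ => z ^ t + (1 - z) ^ t :=
    (Real.continuous_const_rpow h₀.ne').add (Real.continuous_const_rpow h₁.ne')
  have hlt {t : ℝ} (h₀ : 0 < t) (h₁ : t < 1) : x ^ t + (1 - x) ^ t < y ^ t + (1 - y) ^ t :=
    (Real.strictConcaveOn_rpow h₀ h₁).add_reflect_lt (Set.mem_Ici.2 hx₀.le)
      (Set.mem_Ici.2 hx'.le) hxy (by linarith)
  have hpos : 0 < ∫ t in (0 : ℝ)..1, (x ^ t + (1 - x) ^ t) :=
    intervalIntegral.intervalIntegral_pos_of_pos ((hcont hx₀ hx').intervalIntegrable _ _)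
      (fun t => by positivity) one_pos
  simp only
  rw [log_mul_log_div_binEntropy_eq_inv_integral hx₀ (by linarith),
    log_mul_log_div_binEntropy_eq_inv_integral hy₀ (by linarith)]
  refine inv_strictAnti₀ hpos ?_
  refine intervalIntegral.integral_lt_integral_of_continuousOn_of_le_of_exists_lt one_pos
    (hcont hx₀ hx').continuousOn (hcont hy₀ hy').continuousOn ?_
    ⟨1 / 2, by norm_num, hlt (by norm_num) (by norm_num)⟩
  rintro t ⟨ht₀, ht₁⟩
  rcases ht₁.lt_or_eq with ht | rfl
  · exact (hlt ht₀ ht).le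
  · simp
end

section
/- Let k > 1 be real, let α_k be the unique positive solution to x(1+x)^{k-1} = 1, and let h be the binary entropy function. Let q(x) = x^{k-1} h(x) / h(x^k) for 0 < x < 1. Then q(1/(1+α_k)) = α_k. -/
theorem binEntropy_pos_s13 {x : ℝ} (hx₀ : 0 < x) (hx₁ : x < 1) : 0 < binEntropy x := by
  unfold binEntropy
  have h₁ := mul_neg_of_pos_of_neg hx₀ (Real.log_neg hx₀ hx₁)
  have h₂ := mul_neg_of_pos_of_neg (sub_pos.2 hx₁)
    (Real.log_neg (sub_pos.2 hx₁) (sub_lt_self 1 hx₀))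
  linarith

/-- For `k > 1` and `α = α_k` the unique positive solution of
`x (1+x)^(k-1) = 1`, with `q(x) = x^(k-1) h(x) / h(x^k)`,
we have `q(1/(1+α)) = α`. -/
theorem q_at_one_div_one_add_alpha (k α : ℝ) (hk : 1 < k)
    (hα : 0 < α) (hαeq : α * (1 + α) ^ (k - 1) = 1) :
    (1 / (1 + α)) ^ (k - 1) * binEntropy (1 / (1 + α)) /
      binEntropy ((1 / (1 + α)) ^ k) = α := by
  have hpos : 0 < 1 + α := by positivity
  have hx₀ : 0 < 1 / (1 + α) := by positivity
  have hx₁ : 1 / (1 + α) < 1 := (div_lt_one hpos).2 (by linarith)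
  have hpow : (1 / (1 + α)) ^ (k - 1) = α := by
    rw [Real.div_rpow zero_le_one hpos.le, Real.one_rpow]
    exact (eq_one_div_of_mul_eq_one_left hαeq).symm
  have hpow' : (1 / (1 + α)) ^ k = 1 - 1 / (1 + α) := by
    rw [← sub_add_cancel k 1, Real.rpow_add_one hx₀.ne', hpow]
    field_simp
    ring
  rw [hpow, hpow', binEntropy_one_sub]
  exact mul_div_cancel_right₀ α (binEntropy_pos_s13 hx₀ hx₁).ne'
end

section
/- Let k > 1 be real and let h be the binary entropy function. For x in (0,1), if ((k-1)·h(x) + x·h'(x))·h(x^k) = k·x^k·h(x)·h'(x^k), where h'(y) = log(1-y) - log(y), then U(x) = U(x^k), where U(y) = log(y)·log(1-y)/h(y). -/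
/-- The derivative of the binary entropy: `h'(y) = log(1-y) - log y`. -/
noncomputable def binEntropyDeriv (y : ℝ) : ℝ :=
  Real.log (1 - y) - Real.log y

/-- `U(x) = log(x) log(1-x) / h(x)`. -/
noncomputable def U (x : ℝ) : ℝ :=
  Real.log x * Real.log (1 - x) / binEntropy x

theorem mul_binEntropyDeriv (x : ℝ) :
    x * binEntropyDeriv x = binEntropy x + Real.log (1 - x) := by
  unfold binEntropy binEntropyDeriv
  ring

/-- For real `k > 1` and `x ∈ (0,1)`, if
`((k-1) h(x) + x h'(x)) h(x^k) = k x^k h(x) h'(x^k)`, then `U(x) = U(x^k)`. -/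
theorem U_eq_of_critical (k : ℝ) (hk : 1 < k) :
    ∀ x ∈ Set.Ioo (0 : ℝ) 1,
      ((k - 1) * binEntropy x + x * binEntropyDeriv x) * binEntropy (x ^ k) =
          k * x ^ k * binEntropy x * binEntropyDeriv (x ^ k) →
        U x = U (x ^ k) := by
  rintro x ⟨h0, h1⟩ h
  have hpos := binEntropy_pos h0 h1
  have hpos' := binEntropy_pos (Real.rpow_pos_of_pos h0 k)
    (Real.rpow_lt_one h0.le h1 (by linarith))
  have hd := mul_binEntropyDeriv x
  have hd' := mul_binEntropyDeriv (x ^ k)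
  unfold U
  rw [div_eq_div_iff hpos.ne' hpos'.ne', Real.log_rpow h0]
  linear_combination Real.log x * (h - binEntropy (x ^ k) * hd + k * binEntropy x * hd')
end
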